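/- arXiv:2509.03520 — 3 statements merged into one kernel-verified Lean document; each statement's English description precedes it below -/
import Mathlib

section
/- Let k_B > 0 and r > 1 be real constants, μ(n,T) = k_B·T·(log n + 1) − (k_B/(r−1))·T², s(n,T) = −k_B·n·log n + (2k_B/(r−1))·T·n, and p(n,T) = k_B·n·T. Let d ≥ 1, let n, T : ℝ^d → ℝ be differentiable at a point x with n(x) > 0. Then the map y ↦ p(n(y),T(y)) is differentiable at x and its Fréchet derivative satisfies D(p∘(n,T))(x) = n(x)·D(μ∘(n,T))(x) + s(n(x),T(x))·DT(x) as continuous linear maps from ℝ^d to ℝ (the pressure-gradient identity ∇p = n·∇μ + s·∇T). -/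
/-- Chemical potential `μ(n,T) = k_B T (log n + 1) - (k_B/(r-1)) T^2`. -/
noncomputable def helmMu (kB r n T : ℝ) : ℝ :=
  kB * T * (Real.log n + 1) - kB / (r - 1) * T ^ 2

/-- Entropy density `s(n,T) = -k_B n log n + (2 k_B/(r-1)) T n`. -/
noncomputable def helmS (kB r n T : ℝ) : ℝ :=
  -(kB * n * Real.log n) + 2 * kB / (r - 1) * T * n

/-- Pressure `p(n,T) = k_B n T`. -/
noncomputable def helmP (kB n T : ℝ) : ℝ := kB * n * T

theorem stmt_6 (kB r : ℝ) (hkB : 0 < kB) (hr : 1 < r) (d : ℕ) (hd : 1 ≤ d)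
    (n T : EuclideanSpace ℝ (Fin d) → ℝ) (x : EuclideanSpace ℝ (Fin d))
    (hn : DifferentiableAt ℝ n x) (hT : DifferentiableAt ℝ T x) (hpos : 0 < n x) :
    DifferentiableAt ℝ (fun y => helmP kB (n y) (T y)) x ∧
    fderiv ℝ (fun y => helmP kB (n y) (T y)) x
      = n x • fderiv ℝ (fun y => helmMu kB r (n y) (T y)) x
        + helmS kB r (n x) (T x) • fderiv ℝ T x := by
  have hn' := hn.hasFDerivAt
  have hT' := hT.hasFDerivAt
  have hP : HasFDerivAt (fun y => helmP kB (n y) (T y)) _ x := (hn'.const_mul kB).mul hT'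
  have hM : HasFDerivAt (fun y => helmMu kB r (n y) (T y)) _ x :=
    ((hT'.const_mul kB).mul ((hn'.log hpos.ne').add_const 1)).sub
      ((hT'.pow 2).const_mul (kB / (r - 1)))
  refine ⟨hP.differentiableAt, ?_⟩
  rw [hP.fderiv, hM.fderiv]
  ext v
  have h0 : n x ≠ 0 := hpos.ne'
  have h1 : r - 1 ≠ 0 := by linarith
  simp [helmS]
  field_simp
  ring
end

section
/- Let k_B > 0 and r > 1 be real constants, f(n,T) = k_B·T·n·log n − (k_B/(r−1))·T²·n, μ(n,T) = k_B·T·(log n + 1) − (k_B/(r−1))·T², and s(n,T) = −k_B·n·log n + (2k_B/(r−1))·T·n. Then for all n₁, n₂ > 0, all T₁ ∈ ℝ, and all T₂ ≥ 0, the discrete Helmholtz free energy inequality holds: f(n₂,T₂) − f(n₁,T₁) ≤ μ(n₂,T₂)·(n₂ − n₁) − s(n₁,T₁)·(T₂ − T₁). -/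
/-- Helmholtz free energy density `f(n,T) = k_B T n log n - (k_B/(r-1)) T^2 n`. -/
noncomputable def helmF (kB r n T : ℝ) : ℝ :=
  kB * T * n * Real.log n - kB / (r - 1) * T ^ 2 * n

theorem stmt_7 (kB r : ℝ) (hkB : 0 < kB) (hr : 1 < r)
    (n₁ n₂ T₁ T₂ : ℝ) (hn₁ : 0 < n₁) (hn₂ : 0 < n₂) (hT₂ : 0 ≤ T₂) :
    helmF kB r n₂ T₂ - helmF kB r n₁ T₁
      ≤ helmMu kB r n₂ T₂ * (n₂ - n₁) - helmS kB r n₁ T₁ * (T₂ - T₁) := by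
  have hr' : 0 < r - 1 := by linarith
  have h1 : n₁ * (Real.log n₂ - Real.log n₁) ≤ n₂ - n₁ := by
    have h := Real.log_le_sub_one_of_pos (div_pos hn₂ hn₁)
    rw [Real.log_div hn₂.ne' hn₁.ne'] at h
    have h2 := mul_le_mul_of_nonneg_left h hn₁.le
    have h3 : n₁ * (n₂ / n₁ - 1) = n₂ - n₁ := by field_simp
    linarith
  have h2 : 0 ≤ kB * T₂ * (n₂ - n₁ - n₁ * (Real.log n₂ - Real.log n₁)) :=
    mul_nonneg (by positivity) (by linarith)
  have h3 : 0 ≤ kB / (r - 1) * n₁ * (T₂ - T₁) ^ 2 := by positivity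
  unfold helmF helmMu helmS
  rw [mul_div_assoc]
  generalize kB / (r - 1) = c at *
  linarith
end

section
/- Let k_B > 0 and r > 1 be real constants, μ(n,T) = k_B·T·(log n + 1) − (k_B/(r−1))·T², s(n,T) = −k_B·n·log n + (2k_B/(r−1))·T·n, and ε(n,T) = (k_B/(r−1))·n·T². Then for all n₁, n₂ > 0, all T₁ ∈ ℝ, and all T₂ > 0, the pointwise discrete entropy production inequality holds: s(n₂,T₂) − s(n₁,T₁) ≥ (ε(n₂,T₂) − ε(n₁,T₁) − μ(n₂,T₂)·(n₂ − n₁)) / T₂. -/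
/-- Internal energy density `ε(n,T) = (k_B/(r-1)) n T^2`. -/
noncomputable def helmEps (kB r n T : ℝ) : ℝ :=
  kB / (r - 1) * n * T ^ 2

theorem stmt_8 (kB r : ℝ) (hkB : 0 < kB) (hr : 1 < r)
    (n₁ n₂ T₁ T₂ : ℝ) (hn₁ : 0 < n₁) (hn₂ : 0 < n₂) (hT₂ : 0 < T₂) :
    (helmEps kB r n₂ T₂ - helmEps kB r n₁ T₁ - helmMu kB r n₂ T₂ * (n₂ - n₁)) / T₂
      ≤ helmS kB r n₂ T₂ - helmS kB r n₁ T₁ := by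
  have hc : 0 < kB / (r - 1) := div_pos hkB (by linarith)
  have e : 2 * kB / (r - 1) = 2 * (kB / (r - 1)) := by ring
  unfold helmEps helmMu helmS
  rw [e, div_le_iff₀ hT₂]
  generalize kB / (r - 1) = c at hc
  have h1 : Real.log n₂ - Real.log n₁ ≤ n₂ / n₁ - 1 := by
    rw [← Real.log_div hn₂.ne' hn₁.ne']
    exact Real.log_le_sub_one_of_pos (div_pos hn₂ hn₁)
  have h2 : n₁ * (Real.log n₂ - Real.log n₁) ≤ n₂ - n₁ := by
    calc n₁ * (Real.log n₂ - Real.log n₁) ≤ n₁ * (n₂ / n₁ - 1) :=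
          mul_le_mul_of_nonneg_left h1 hn₁.le
      _ = n₂ - n₁ := by field_simp
  have h3 : 0 ≤ kB * T₂ * (n₂ - n₁ - n₁ * (Real.log n₂ - Real.log n₁)) :=
    mul_nonneg (mul_pos hkB hT₂).le (by linarith)
  have h4 : 0 ≤ c * n₁ * (T₁ - T₂) ^ 2 := by positivity
  linarith [h3, h4]
end
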